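/- Let m ≥ 1, p = 17, p1 = 67, N = 67^m, and q = 17^{33·67^{m−1}}. Then for every k with 0 ≤ k ≤ 66, the Cayley graph Cay(F_q, D_k) is a strongly regular graph of degree (q−1)/67, where D_k = ∪_{i=0}^{67^{m−1}−1} C_{i + k·67^{m−1}}. -/

import Mathlib

open scoped Classical

noncomputable section

open scoped NNReal

/-- The ring of integers of the algebraic closure of `ℚ_[p]`. -/
abbrev PadicAlgInt (p : ℕ) [Fact p.Prime] : ValuationSubring (PadicAlgCl p) :=
  (Valued.v : Valuation (PadicAlgCl p) ℝ≥0).valuationSubring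

namespace PadicAlgInt

variable (p : ℕ) [Fact p.Prime]

/-- The residue field of `PadicAlgInt p`. -/
abbrev Residue : Type := IsLocalRing.ResidueField (PadicAlgInt p)

/-- The reduction map of `PadicAlgInt p`. -/
abbrev red : PadicAlgInt p →+* Residue p := IsLocalRing.residue _

/-- The `p`-adic valuation, normalised by `val p p = p⁻¹`. -/
def val : Valuation (PadicAlgInt p) ℝ≥0 :=
  (Valued.v : Valuation (PadicAlgCl p) ℝ≥0).comap (algebraMap (PadicAlgInt p) (PadicAlgCl p))

theorem val_le_one (x : PadicAlgInt p) : val p x ≤ 1 := x.2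

theorem val_lt_one_iff (x : PadicAlgInt p) : val p x < 1 ↔ red p x = 0 := by
  rw [IsLocalRing.residue_eq_zero_iff, IsLocalRing.mem_maximalIdeal, mem_nonunits_iff,
    (Valuation.valuationSubring.integers _).isUnit_iff_valuation_eq_one]
  exact ⟨fun h => h.ne, fun h => lt_of_le_of_ne (val_le_one p x) h⟩

theorem val_intCast_le_iff (a : ℤ) (n : ℕ) :
    val p (a : PadicAlgInt p) ≤ (p : ℝ≥0)⁻¹ ^ n ↔ (p : ℤ) ^ n ∣ a := by
  rw [← Padic.norm_int_le_pow_iff_dvd (p := p) a n, ← PadicAlgCl.norm_extends, ← NNReal.coe_le_coe]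
  have : ((val p (a : PadicAlgInt p) : ℝ≥0) : ℝ) = ‖((a : ℚ_[p]) : PadicAlgCl p)‖ := by
    simp [val]
  rw [this]
  simp

theorem val_natCast_self : val p (p : PadicAlgInt p) = (p : ℝ≥0)⁻¹ := by
  have := PadicAlgCl.valuation_p p
  simpa [val] using this

instance charP_residue : CharP (Residue p) p := by
  have h : ((p : ℕ) : Residue p) = 0 := by
    rw [← map_natCast (red p), ← val_lt_one_iff, val_natCast_self]
    exact inv_lt_one_of_one_lt₀ (by exact_mod_cast (Fact.out : p.Prime).one_lt)
  exact (CharP.charP_iff_prime_eq_zero Fact.out).2 h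

theorem exists_isPrimitiveRoot (n : ℕ) [NeZero n] :
    ∃ ζ : PadicAlgInt p, IsPrimitiveRoot ζ n := by
  obtain ⟨ζ, hζ⟩ := HasEnoughRootsOfUnity.exists_primitiveRoot (PadicAlgCl p) n
  have hv : (Valued.v ζ : ℝ≥0) = 1 := by
    have := congrArg (Valued.v : Valuation (PadicAlgCl p) ℝ≥0) hζ.pow_eq_one
    rw [map_pow, map_one] at this
    exact (pow_eq_one_iff_of_nonneg zero_le (NeZero.ne n)).1 this
  refine ⟨⟨ζ, ?_⟩, ?_⟩
  · exact (Valuation.mem_valuationSubring_iff _ _).2 hv.le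
  · exact IsPrimitiveRoot.coe_submonoidClass_iff.1 hζ

theorem red_sub_one_of_isPrimitiveRoot {ζ : PadicAlgInt p} (hζ : IsPrimitiveRoot ζ p) :
    red p (ζ - 1) = 0 := by
  have : (red p (ζ - 1)) ^ p = 0 := by
    rw [map_sub, map_one, sub_pow_char, ← map_pow, hζ.pow_eq_one]
    simp
  exact pow_eq_zero_iff (Fact.out : p.Prime).ne_zero |>.1 this

theorem inv_le_val_sub_one_pow {ζ : PadicAlgInt p} (hζ : IsPrimitiveRoot ζ p) :
    (p : ℝ≥0)⁻¹ ≤ val p (ζ - 1) ^ (p - 1) := by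
  have h := Polynomial.eval_one_cyclotomic_prime (R := PadicAlgInt p) (p := p)
  rw [Polynomial.cyclotomic_eq_prod_X_sub_primitiveRoots hζ, Polynomial.eval_prod] at h
  rw [← val_natCast_self, ← h, map_prod, ← Nat.totient_prime Fact.out, ← hζ.card_primitiveRoots]
  refine Finset.prod_le_pow_card _ _ _ fun μ hμ => ?_
  obtain ⟨i, -, rfl⟩ := hζ.eq_pow_of_pow_eq_one
    (isPrimitiveRoot_of_mem_primitiveRoots hμ).pow_eq_one
  rw [Polynomial.eval_sub, Polynomial.eval_X, Polynomial.eval_C, Valuation.map_sub_swap,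
    ← geom_sum_mul, map_mul]
  exact mul_le_of_le_one_left' (val_le_one p _)

variable (F : Type) [Field F] [Fintype F] [Algebra (ZMod p) F]

theorem exists_teichmuller :
    ∃ (σ : F →+* Residue p) (ω : MulChar F (PadicAlgInt p)), ∀ x, red p (ω x) = σ x := by
  have hcard : 1 < Fintype.card F := Fintype.one_lt_card
  set n := Fintype.card F - 1 with hn
  have hn0 : 0 < n := by omega
  have : NeZero n := ⟨hn0.ne'⟩
  obtain ⟨μ, hμ⟩ := exists_isPrimitiveRoot p n
  have hprod : (Polynomial.X ^ n - 1 : Polynomial (Residue p)) =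
      ∏ r ∈ Polynomial.nthRootsFinset n (1 : PadicAlgInt p),
        (Polynomial.X - Polynomial.C (red p r)) := by
    have := congrArg (Polynomial.map (red p)) (Polynomial.X_pow_sub_one_eq_prod hn0 hμ)
    simpa [Polynomial.map_prod] using this
  let : Algebra (ZMod p) (Residue p) := ZMod.algebra _ p
  have hsplit : (Polynomial.map (algebraMap (ZMod p) (Residue p))
      (Polynomial.X ^ Fintype.card F - Polynomial.X)).Splits := by
    have : (Polynomial.X ^ Fintype.card F - Polynomial.X : Polynomial (Residue p)) =
        Polynomial.X * (Polynomial.X ^ n - 1) := by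
      rw [show Fintype.card F = n + 1 by omega]; ring
    simp only [Polynomial.map_sub, Polynomial.map_pow, Polynomial.map_X]
    rw [this, hprod]
    exact Polynomial.Splits.X.mul (Polynomial.Splits.prod fun r _ => Polynomial.Splits.X_sub_C _)
  have := FiniteField.isSplittingField_sub F (ZMod p)
  let σ : F →+* Residue p := (Polynomial.IsSplittingField.lift F _ hsplit : F →ₐ[ZMod p] _)
  obtain ⟨g, hg⟩ := IsCyclic.exists_generator (α := Fˣ)
  have hgn : (g : F) ^ n = 1 := FiniteField.pow_card_sub_one_eq_one _ g.ne_zero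
  have h0 : ∏ r ∈ Polynomial.nthRootsFinset n (1 : PadicAlgInt p), (σ g - red p r) = 0 := by
    have := congrArg (Polynomial.eval (σ g)) hprod
    rw [Polynomial.eval_prod] at this
    simp only [Polynomial.eval_sub, Polynomial.eval_pow, Polynomial.eval_X, Polynomial.eval_one,
      Polynomial.eval_C] at this
    rw [← this, ← map_pow, hgn, map_one, sub_self]
  obtain ⟨r, hr, hr0⟩ := Finset.prod_eq_zero_iff.1 h0
  have hrn : r ^ n = 1 := (Polynomial.mem_nthRootsFinset hn0 1).1 hr
  have hu : IsUnit r := IsUnit.of_pow_eq_one hrn hn0.ne'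
  have hmem : hu.unit ∈ rootsOfUnity (Fintype.card Fˣ) (PadicAlgInt p) := by
    rw [mem_rootsOfUnity, Fintype.card_units]
    ext1
    simpa using hrn
  refine ⟨σ, MulChar.ofRootOfUnity hmem hg, fun x => ?_⟩
  rcases eq_or_ne x 0 with rfl | hx
  · rw [MulChar.map_zero, map_zero, map_zero]
  · obtain ⟨i, hi⟩ := (IsOfFinOrder.mem_powers_iff_mem_zpowers (isOfFinOrder_of_finite g)).2
      (hg (Units.mk0 x hx))
    have hxg : x = (g : F) ^ i := by
      have := congrArg Units.val hi
      simpa using this.symm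
    rw [hxg, map_pow, map_pow, map_pow, MulChar.ofRootOfUnity_spec, IsUnit.unit_spec,
      sub_eq_zero.1 hr0]

end PadicAlgInt
namespace PadicAlgInt

variable {p : ℕ} [Fact p.Prime] {F : Type} [Field F] [Fintype F] [Algebra (ZMod p) F]
  {ζ : PadicAlgInt p}

variable (F) in
/-- The additive character `x ↦ ζ ^ Tr x` of `F`. -/
def traceChar (hζ : IsPrimitiveRoot ζ p) : AddChar F (PadicAlgInt p) :=
  (AddChar.zmodChar p hζ.pow_eq_one).compAddMonoidHom (Algebra.trace (ZMod p) F).toAddMonoidHom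

omit [Fintype F] in
theorem traceChar_apply (hζ : IsPrimitiveRoot ζ p) (x : F) :
    traceChar F hζ x = ζ ^ (Algebra.trace (ZMod p) F x).val := rfl

theorem traceChar_ne_one (hζ : IsPrimitiveRoot ζ p) : traceChar F hζ ≠ 1 := by
  intro h
  obtain ⟨x, hx⟩ := Algebra.trace_surjective (ZMod p) F 1
  have := DFunLike.congr_fun h x
  have hp : 1 < p := (Fact.out : p.Prime).one_lt
  have : Fact (1 < p) := ⟨hp⟩
  rw [traceChar_apply, hx, ZMod.val_one, pow_one, AddChar.one_apply] at *
  exact hζ.ne_one hp (by assumption)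

theorem traceChar_isPrimitive (hζ : IsPrimitiveRoot ζ p) : (traceChar F hζ).IsPrimitive :=
  AddChar.IsPrimitive.of_ne_one (traceChar_ne_one hζ)

theorem traceChar_pow (hζ : IsPrimitiveRoot ζ p) (x : F) :
    traceChar F hζ (x ^ p) = traceChar F hζ x := by
  have := Algebra.trace_eq_of_algEquiv (FiniteField.frobeniusAlgEquivOfAlgebraic (ZMod p) F) x
  simp only [FiniteField.coe_frobeniusAlgEquivOfAlgebraic, ZMod.card] at this
  rw [traceChar_apply, this, traceChar_apply]

theorem gaussSum_pow_char (hζ : IsPrimitiveRoot ζ p) (χ : MulChar F (PadicAlgInt p)) :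
    gaussSum (χ ^ p) (traceChar F hζ) = gaussSum χ (traceChar F hζ) := by
  refine Eq.trans ?_ ((FiniteField.frobeniusAlgEquivOfAlgebraic (ZMod p) F).toEquiv.sum_comp _)
  refine Finset.sum_congr rfl fun x _ => ?_
  have : (FiniteField.frobeniusAlgEquivOfAlgebraic (ZMod p) F).toEquiv x = x ^ p := by
    simp
  rw [this, traceChar_pow, MulChar.pow_apply' _ (Fact.out : p.Prime).ne_zero, map_pow]

section Teichmuller

variable {σ : F →+* Residue p} {ω : MulChar F (PadicAlgInt p)} (hω : ∀ x, red p (ω x) = σ x)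

include hω

omit [Fintype F] [Algebra (ZMod p) F] in
theorem teichmuller_injective : Function.Injective ω := fun x y h =>
  σ.injective (by rw [← hω, ← hω, h])

omit [Algebra (ZMod p) F] in
theorem teichmuller_inv_pow_ne_one {n : ℕ} (h0 : 0 < n) (hn : n < Fintype.card F - 1) :
    ω⁻¹ ^ n ≠ 1 := by
  intro h
  obtain ⟨g, hg⟩ := IsCyclic.exists_generator (α := Fˣ)
  have ho : orderOf g = Fintype.card F - 1 := by
    rw [orderOf_eq_card_of_forall_mem_zpowers hg, Nat.card_eq_fintype_card, Fintype.card_units]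
  rw [inv_pow, inv_eq_one] at h
  have h1 := DFunLike.congr_fun h (g : F)
  rw [MulChar.pow_apply' _ h0.ne', ← map_pow, MulChar.one_apply_coe, ← map_one ω] at h1
  have h2 : g ^ n = 1 := by
    ext1
    simpa using teichmuller_injective hω h1
  have := Nat.le_of_dvd h0 (orderOf_dvd_of_pow_eq_one h2)
  omega

theorem val_gaussSum_mul_le (hζ : IsPrimitiveRoot ζ p) {a b : ℕ}
    (h : a + b < Fintype.card F - 1) :
    val p (gaussSum (ω⁻¹ ^ a) (traceChar F hζ)) * val p (gaussSum (ω⁻¹ ^ b) (traceChar F hζ)) ≤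
      val p (gaussSum (ω⁻¹ ^ (a + b)) (traceChar F hζ)) := by
  rcases Nat.eq_zero_or_pos (a + b) with h0 | h0
  · obtain ⟨rfl, rfl⟩ : a = 0 ∧ b = 0 := by omega
    simp [gaussSum_one_left (traceChar_ne_one hζ)]
  · have hne := teichmuller_inv_pow_ne_one hω h0 h
    rw [pow_add] at hne ⊢
    rw [← map_mul, ← jacobiSum_mul_nontrivial hne, map_mul]
    exact mul_le_of_le_one_right' (val_le_one p _)

theorem val_sub_one_le_val_gaussSum (hζ : IsPrimitiveRoot ζ p) (hF : 1 < Fintype.card F - 1) :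
    val p (ζ - 1) ≤ val p (gaussSum ω⁻¹ (traceChar F hζ)) := by
  set tr := fun x : F => Algebra.trace (ZMod p) F x
  set W := ∑ x : F, ω⁻¹ x * ∑ i ∈ Finset.range (tr x).val, ζ ^ i with hW
  have h1 : gaussSum ω⁻¹ (traceChar F hζ) = W * (ζ - 1) := by
    have hs : ∑ x, ω⁻¹ x = 0 := MulChar.sum_eq_zero_of_ne_one
      (by simpa using teichmuller_inv_pow_ne_one hω one_pos hF)
    rw [hW, Finset.sum_mul, gaussSum, ← sub_zero (∑ x, _), ← hs, ← Finset.sum_sub_distrib]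
    refine Finset.sum_congr rfl fun x _ => ?_
    rw [mul_assoc, geom_sum_mul, traceChar_apply]
    ring
  have hred : red p ζ = 1 := by
    have := red_sub_one_of_isPrimitiveRoot p hζ
    rwa [map_sub, map_one, sub_eq_zero] at this
  have hσ : ∀ x : F, (((tr x).val : ℕ) : Residue p) =
      σ (∑ i ∈ Finset.range (Module.finrank (ZMod p) F), x ^ p ^ i) := fun x => by
    have := FiniteField.algebraMap_trace_eq_sum_pow (ZMod p) F x
    rw [Nat.card_zmod] at this
    rw [← this, ← map_natCast σ, ← map_natCast (algebraMap (ZMod p) F), ZMod.natCast_zmod_val]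
  have h2 : red p W = -1 := by
    have : red p W = σ (∑ x : F, x⁻¹ *
        ∑ i ∈ Finset.range (Module.finrank (ZMod p) F), x ^ p ^ i) := by
      rw [hW, map_sum, map_sum]
      refine Finset.sum_congr rfl fun x _ => ?_
      rw [map_mul, map_mul, MulChar.inv_apply', hω, map_sum, ← hσ]
      simp [hred]
    rw [this, ← map_one σ, ← map_neg]
    congr 1
    simp_rw [Finset.mul_sum]
    rw [Finset.sum_comm]
    have hq : Fintype.card F = p ^ Module.finrank (ZMod p) F := by
      simpa using Module.card_eq_pow_finrank (K := ZMod p) (V := F)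
    have hterm : ∀ i ∈ Finset.range (Module.finrank (ZMod p) F),
        ∑ x : F, x⁻¹ * x ^ p ^ i = if i = 0 then -1 else 0 := by
      intro i hi
      have hpi : 0 < p ^ i := pow_pos (Fact.out : p.Prime).pos i
      have hu : ∑ x : F, x⁻¹ * x ^ p ^ i = ∑ x : Fˣ, (x : F) ^ (p ^ i - 1) := by
        refine (Fintype.sum_of_injective Units.val Units.val_injective _ _ (fun x hx => ?_)
          fun u => ?_).symm
        · have : x = 0 := by
            by_contra h
            exact hx ⟨Units.mk0 x h, rfl⟩
          rw [this, inv_zero, zero_mul]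
        · rw [← pow_sub_one_mul hpi.ne', mul_comm, mul_assoc, mul_inv_cancel₀ u.ne_zero, mul_one]
      rw [hu, FiniteField.sum_pow_units]
      congr 1
      have hlt : p ^ i < p ^ Module.finrank (ZMod p) F :=
        Nat.pow_lt_pow_right (Fact.out : p.Prime).one_lt (Finset.mem_range.1 hi)
      rw [eq_iff_iff]
      constructor
      · intro h
        have := Nat.eq_zero_of_dvd_of_lt h (by omega)
        by_contra hi0
        have := Nat.one_lt_pow hi0 (Fact.out : p.Prime).one_lt
        omega
      · rintro rfl
        simp
    rw [Finset.sum_congr rfl hterm, Finset.sum_ite_eq' (Finset.range _) 0 (fun _ => (-1 : F)),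
      if_pos (Finset.mem_range.2 Module.finrank_pos)]
  have h3 : val p W = 1 := by
    refine le_antisymm (val_le_one p _) (not_lt.1 fun h => ?_)
    rw [val_lt_one_iff, h2] at h
    simp at h
  rw [h1, map_mul, h3, one_mul]

theorem val_sub_one_pow_le_val_gaussSum (hζ : IsPrimitiveRoot ζ p) (hF : 1 < Fintype.card F - 1)
    {d : ℕ} (hd : d < Fintype.card F - 1) :
    val p (ζ - 1) ^ d ≤ val p (gaussSum (ω⁻¹ ^ d) (traceChar F hζ)) := by
  induction d with
  | zero => simp [gaussSum_one_left (traceChar_ne_one hζ)]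
  | succ d ih =>
    refine le_trans ?_ (val_gaussSum_mul_le hω hζ hd)
    rw [pow_succ, pow_one]
    exact mul_le_mul' (ih (by omega)) (val_sub_one_le_val_gaussSum hω hζ hF)

/-- The easy half of Stickelberger's theorem on the valuation of Gauss sums, stated with the
base `p` expansion of `t / N`. -/
theorem val_sub_one_pow_sum_le (hζ : IsPrimitiveRoot ζ p) (hF : 1 < Fintype.card F - 1)
    {N t J : ℕ} (ht : t < N) (h : p ^ J * t / N < Fintype.card F - 1) :
    val p (ζ - 1) ^ (∑ j ∈ Finset.range J, p * (p ^ j * t % N) / N) ≤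
      val p (gaussSum (ω⁻¹ ^ (p ^ J * t / N)) (traceChar F hζ)) := by
  induction J with
  | zero =>
    simp [Nat.div_eq_of_lt ht, gaussSum_one_left (traceChar_ne_one hζ)]
  | succ J ih =>
    have hN : 0 < N := by omega
    have hstep : p ^ (J + 1) * t / N = p ^ J * t / N * p + p * (p ^ J * t % N) / N := by
      have : p ^ (J + 1) * t = p * (p ^ J * t % N) + N * (p ^ J * t / N * p) := by
        conv_lhs => rw [pow_succ', mul_assoc, ← Nat.div_add_mod (p ^ J * t) N]
        ring
      rw [this, Nat.add_mul_div_left _ _ hN, add_comm]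
    have hp : 1 ≤ p := (Fact.out : p.Prime).one_lt.le
    have hle : p ^ J * t / N ≤ p ^ J * t / N * p := Nat.le_mul_of_pos_right _ hp
    rw [hstep] at h ⊢
    refine le_trans ?_ (val_gaussSum_mul_le hω hζ h)
    rw [Finset.sum_range_succ, pow_add, pow_mul ω⁻¹, gaussSum_pow_char]
    exact mul_le_mul' (ih (((hle.trans (Nat.le_add_right _ _))).trans_lt h))
      (val_sub_one_pow_le_val_gaussSum hω hζ hF ((Nat.le_add_left _ _).trans_lt h))

end Teichmuller

end PadicAlgInt
section Arithmetic

theorem orderOf_seventeen : orderOf (17 : ZMod 67) = 33 := by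
  rw [orderOf_eq_iff (by norm_num)]
  decide +kernel

theorem pow_dvd_pow_sub_one_iff (s n : ℕ) : 67 ^ (s + 1) ∣ 17 ^ n - 1 ↔ 33 * 67 ^ s ∣ n := by
  rcases Nat.eq_zero_or_pos n with rfl | hn
  · simp
  have h67 : Fact (Nat.Prime 67) := ⟨by norm_num⟩
  have key : ∀ k, 67 ∣ 17 ^ k - 1 ↔ 33 ∣ k := fun k => by
    rw [← orderOf_seventeen, orderOf_dvd_iff_pow_eq_one,
      ← Nat.modEq_iff_dvd' (Nat.one_le_pow _ _ (by norm_num)),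
      ← ZMod.natCast_eq_natCast_iff]
    push_cast
    exact eq_comm
  have hval : ∀ k, 0 < k → padicValNat 67 (17 ^ (33 * k) - 1) = 1 + padicValNat 67 k := by
    intro k hk
    rw [pow_mul]
    have := padicValNat.pow_sub_pow (p := 67) (x := 17 ^ 33) (y := 1) (by decide) (by norm_num)
      (by norm_num) (by norm_num) (n := k) hk.ne'
    rw [one_pow] at this
    rw [this]
    congr 1
    have h1 : (17 : ℕ) ^ 33 - 1 = 67 ^ 1 * ((17 ^ 33 - 1) / 67) := by norm_num
    rw [h1, padicValNat.mul (by norm_num) (by norm_num), padicValNat.prime_pow,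
      padicValNat.eq_zero_of_not_dvd (by norm_num)]
  constructor
  · intro h
    obtain ⟨k, rfl⟩ := (key n).1 ((dvd_pow_self 67 (Nat.succ_ne_zero s)).trans h)
    have hk : 0 < k := Nat.pos_of_mul_pos_left hn
    refine Nat.mul_dvd_mul_left _ ?_
    have hne : 17 ^ (33 * k) - 1 ≠ 0 :=
      Nat.sub_ne_zero_of_lt (Nat.one_lt_pow (by omega) (by norm_num))
    rw [padicValNat_dvd_iff_le hne, hval k hk] at h
    rw [padicValNat_dvd_iff_le hk.ne']
    omega
  · rintro ⟨k, rfl⟩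
    have hk : 0 < k := Nat.pos_of_mul_pos_left hn
    rw [mul_assoc] at hn ⊢
    have hne : 17 ^ (33 * (67 ^ s * k)) - 1 ≠ 0 :=
      Nat.sub_ne_zero_of_lt (Nat.one_lt_pow hn.ne' (by norm_num))
    rw [padicValNat_dvd_iff_le hne, hval _ (by positivity),
      padicValNat.mul (by positivity) hk.ne', padicValNat.prime_pow]
    omega

theorem pow_mod_injOn (s : ℕ) :
    Set.InjOn (fun i => 17 ^ i % 67 ^ (s + 1)) (Finset.range (33 * 67 ^ s)) := by
  have aux : ∀ i j, i ≤ j → j < 33 * 67 ^ s → 17 ^ i ≡ 17 ^ j [MOD 67 ^ (s + 1)] → i = j := by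
    intro i j hij hj h
    obtain ⟨d, rfl⟩ := Nat.exists_eq_add_of_le hij
    rw [pow_add 17 i d] at h
    nth_rw 1 [← mul_one (17 ^ i)] at h
    have h1 : 1 ≡ 17 ^ d [MOD 67 ^ (s + 1)] :=
      Nat.ModEq.cancel_left_of_coprime (Nat.Coprime.pow _ _ (by norm_num)) h
    rw [Nat.modEq_iff_dvd' (Nat.one_le_pow _ _ (by norm_num)), pow_dvd_pow_sub_one_iff] at h1
    have := Nat.eq_zero_of_dvd_of_lt h1 (by omega)
    omega
  intro i hi j hj h
  simp only [Finset.coe_range, Set.mem_Iio] at hi hj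
  rcases le_total i j with hij | hij
  · exact aux i j hij hj h
  · exact (aux j i hij hi h.symm).symm

/-- The nonzero squares modulo `67`. -/
def squares67 : Finset ℕ := (Finset.range 33).image fun i => 17 ^ i % 67

theorem card_squares67 : squares67.card = 33 := by decide +kernel

theorem sum_squares67 : ∑ r ∈ squares67, r = 1072 := by decide +kernel

theorem squares67_subset : squares67 ⊆ Finset.range 67 := by decide +kernel

theorem sum_range_filter_mod {n : ℕ} {S : Finset ℕ} (hS : S ⊆ Finset.range n) (g : ℕ → ℕ) (M : ℕ) :
    ∑ x ∈ (Finset.range (n * M)).filter (· % n ∈ S), g x =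
      ∑ j ∈ Finset.range M, ∑ r ∈ S, g (n * j + r) := by
  rw [Finset.sum_filter]
  induction M with
  | zero => simp
  | succ M ih =>
    rw [mul_add, mul_one, Finset.sum_range_add, ih, Finset.sum_range_succ]
    congr 1
    rw [← Finset.sum_subset hS fun r hr hr' => ?_]
    · refine Finset.sum_congr rfl fun r hr => ?_
      rw [Nat.mul_add_mod, Nat.mod_eq_of_lt (Finset.mem_range.1 (hS hr)), if_pos hr]
    · rw [Nat.mul_add_mod, Nat.mod_eq_of_lt (Finset.mem_range.1 hr), if_neg hr']

theorem image_pow_mod (s : ℕ) :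
    (Finset.range (33 * 67 ^ s)).image (fun i => 17 ^ i % 67 ^ (s + 1)) =
      (Finset.range (67 * 67 ^ s)).filter (· % 67 ∈ squares67) := by
  refine Finset.eq_of_subset_of_card_le (fun x hx => ?_) ?_
  · obtain ⟨i, -, rfl⟩ := Finset.mem_image.1 hx
    rw [Finset.mem_filter, Finset.mem_range, ← pow_succ']
    refine ⟨Nat.mod_lt _ (by positivity), ?_⟩
    rw [Nat.mod_mod_of_dvd _ (dvd_pow_self 67 (Nat.succ_ne_zero s)), squares67, Finset.mem_image]
    refine ⟨i % 33, Finset.mem_range.2 (Nat.mod_lt _ (by norm_num)), ?_⟩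
    conv_rhs => rw [← Nat.div_add_mod i 33, pow_add, pow_mul, Nat.mul_mod, Nat.pow_mod]
    norm_num
  · rw [Finset.card_image_of_injOn (pow_mod_injOn s), Finset.card_range, Finset.card_eq_sum_ones,
      sum_range_filter_mod squares67_subset]
    simp [card_squares67, mul_comm]

theorem sum_pow_mod (s : ℕ) :
    2 * ∑ i ∈ Finset.range (33 * 67 ^ s), 17 ^ i % 67 ^ (s + 1) + 67 ^ (s + 1) =
      67 ^ (s + 1) * (33 * 67 ^ s) := by
  have h := Finset.sum_image (f := fun x : ℕ => x) (pow_mod_injOn s)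
  rw [image_pow_mod, sum_range_filter_mod squares67_subset] at h
  rw [← h]
  have hs : ∀ M : ℕ, 2 * ∑ j ∈ Finset.range M, ∑ r ∈ squares67, (67 * j + r) + 67 * M =
      67 * M * (33 * M) := by
    intro M
    induction M with
    | zero => simp
    | succ M ih =>
      rw [Finset.sum_range_succ, mul_add]
      have : ∑ r ∈ squares67, (67 * M + r) = 33 * (67 * M) + 1072 := by
        rw [Finset.sum_add_distrib, sum_squares67, Finset.sum_const, card_squares67, smul_eq_mul]
      rw [this]
      linarith
  rw [pow_succ', hs]

theorem pow_mod_period (s t : ℕ) :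
    17 ^ (33 * 67 ^ s) * t % 67 ^ (s + 1) = t % 67 ^ (s + 1) := by
  have h := (Nat.modEq_iff_dvd' (Nat.one_le_pow _ _ (by norm_num))).2
    ((pow_dvd_pow_sub_one_iff s _).2 dvd_rfl)
  simpa [Nat.ModEq] using (h.mul_right t).symm

theorem sum_digits_eq (s t : ℕ) :
    67 ^ (s + 1) * ∑ j ∈ Finset.range (33 * 67 ^ s), 17 * (17 ^ j * t % 67 ^ (s + 1)) / 67 ^ (s + 1) =
      16 * ∑ j ∈ Finset.range (33 * 67 ^ s), 17 ^ j * t % 67 ^ (s + 1) := by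
  set N := 67 ^ (s + 1)
  have h : ∀ J, N * ∑ j ∈ Finset.range J, 17 * (17 ^ j * t % N) / N + 17 ^ J * t % N =
      16 * ∑ j ∈ Finset.range J, 17 ^ j * t % N + t % N := by
    intro J
    induction J with
    | zero => simp
    | succ J ih =>
      have h1 : 17 ^ (J + 1) * t % N = 17 * (17 ^ J * t % N) % N := by
        rw [Nat.mul_mod_mod, pow_succ', mul_assoc]
      have h2 := Nat.div_add_mod (17 * (17 ^ J * t % N)) N
      rw [Finset.sum_range_succ, Finset.sum_range_succ, h1, mul_add]
      linarith
  have := h (33 * 67 ^ s)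
  rw [pow_mod_period] at this
  exact Nat.add_right_cancel this

theorem sum_digits_one_le (s : ℕ) :
    ∑ j ∈ Finset.range (33 * 67 ^ s), 17 * (17 ^ j * 1 % 67 ^ (s + 1)) / 67 ^ (s + 1) ≤
      8 * (33 * 67 ^ s + 1) := by
  have h1 := sum_digits_eq s 1
  have h2 := sum_pow_mod s
  simp only [mul_one] at *
  have : 0 < 67 ^ (s + 1) := by positivity
  refine Nat.le_of_mul_le_mul_left ?_ this
  linarith

theorem sum_digits_neg_one_le (s : ℕ) :
    ∑ j ∈ Finset.range (33 * 67 ^ s),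
      17 * (17 ^ j * (67 ^ (s + 1) - 1) % 67 ^ (s + 1)) / 67 ^ (s + 1) ≤
      8 * (33 * 67 ^ s + 1) := by
  have h1 := sum_digits_eq s (67 ^ (s + 1) - 1)
  have h2 := sum_pow_mod s
  have hpos : 0 < 67 ^ (s + 1) := by positivity
  have h3 : ∀ j, 17 ^ j * (67 ^ (s + 1) - 1) % 67 ^ (s + 1) + 17 ^ j % 67 ^ (s + 1) =
      67 ^ (s + 1) := by
    intro j
    set N := 67 ^ (s + 1)
    have hlt := Nat.mod_lt (17 ^ j) hpos
    have hne : 17 ^ j % N ≠ 0 := fun h => by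
      have hc : Nat.Coprime N (17 ^ j) := Nat.Coprime.pow _ _ (by norm_num)
      have := hc.eq_one_of_dvd (Nat.dvd_of_mod_eq_zero h)
      exact absurd this (Nat.one_lt_pow (Nat.succ_ne_zero s) (by norm_num)).ne'
    have hd : N ∣ 17 ^ j * (N - 1) % N + 17 ^ j % N := by
      rw [Nat.dvd_iff_mod_eq_zero, ← Nat.add_mod, ← Nat.mul_succ, Nat.succ_eq_add_one,
        Nat.sub_add_cancel hpos, Nat.mul_mod_left]
    have hlt' := Nat.mod_lt (17 ^ j * (N - 1)) hpos
    obtain ⟨c, hc⟩ := hd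
    have : c = 1 := by
      rcases c with _ | _ | c
      · omega
      · rfl
      · nlinarith
    rw [hc, this, mul_one]
  have h4 := Finset.sum_congr (rfl : Finset.range (33 * 67 ^ s) = _) fun j _ => h3 j
  rw [Finset.sum_add_distrib, Finset.sum_const, Finset.card_range, smul_eq_mul] at h4
  refine Nat.le_of_mul_le_mul_left ?_ hpos
  linarith

end Arithmetic
section ClassSums

instance : Fact (Nat.Prime 67) := ⟨by norm_num⟩

variable {s : ℕ}

theorem exists_pow_eq (s : ℕ) {u : ℕ} (hu : u % 67 = 1) :
    ∃ i, (17 : ZMod (67 ^ (s + 1))) ^ i = u := by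
  have hmem : u % 67 ^ (s + 1) ∈ (Finset.range (67 * 67 ^ s)).filter (· % 67 ∈ squares67) := by
    rw [Finset.mem_filter, Finset.mem_range, ← pow_succ',
      Nat.mod_mod_of_dvd _ (dvd_pow_self 67 (Nat.succ_ne_zero s)), hu]
    exact ⟨Nat.mod_lt _ (by positivity), by decide +kernel⟩
  rw [← image_pow_mod, Finset.mem_image] at hmem
  obtain ⟨i, -, hi⟩ := hmem
  exact ⟨i, by exact_mod_cast (ZMod.natCast_eq_natCast_iff (17 ^ i) u _).2 hi⟩

theorem mul_modEq_self {a b n : ℕ} (h : b % n = 1) : a * b ≡ a [MOD a * n] := by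
  have h1 : b ≡ 1 [MOD n] := by
    rw [Nat.ModEq, ← h, Nat.mod_mod]
  simpa using h1.mul_left' a

theorem exists_pow_mul_eq_add {n : ℕ} (hn : ¬ 67 ^ s ∣ n) :
    ∃ i, (17 : ZMod (67 ^ (s + 1))) ^ i * n = n + (67 ^ s : ℕ) := by
  have hn0 : n ≠ 0 := fun h => hn (h ▸ dvd_zero _)
  obtain ⟨v, w, hw, rfl⟩ := Nat.exists_eq_pow_mul_and_not_dvd hn0 67 (by norm_num)
  have hv : v < s := by
    by_contra h
    exact hn (Dvd.dvd.mul_right (pow_dvd_pow _ (not_lt.1 h)) _)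
  have hcop : Nat.Coprime w 67 := ((Nat.Prime.coprime_iff_not_dvd (by norm_num)).2 hw).symm
  obtain ⟨y, hy⟩ := Nat.exists_mul_mod_eq_one_of_coprime hcop (by norm_num)
  obtain ⟨e, rfl⟩ := Nat.exists_eq_add_of_lt hv
  obtain ⟨i, hi⟩ := exists_pow_eq (v + e + 1) (u := 1 + 67 ^ (e + 1) * y) (by
    rw [pow_succ', mul_assoc, Nat.add_mul_mod_self_left])
  refine ⟨i, ?_⟩
  rw [hi]
  norm_cast
  rw [ZMod.natCast_eq_natCast_iff]
  have h1 : (1 + 67 ^ (e + 1) * y) * (67 ^ v * w) = 67 ^ v * w + 67 ^ (v + e + 1) * (w * y) := by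
    ring
  rw [h1]
  refine Nat.ModEq.add_left _ ?_
  rw [pow_succ _ (v + e + 1)]
  exact mul_modEq_self hy.2

theorem mul_natCast_eq_zero (s : ℕ) : ((67 * 67 ^ s : ℕ) : ZMod (67 ^ (s + 1))) = 0 := by
  rw [← pow_succ']
  exact ZMod.natCast_self _

variable (s) in
/-- The embedding of `ZMod 67` in `ZMod (67 ^ (s + 1))` as the multiples of `67 ^ s`. -/
def inflate : ZMod 67 →+ ZMod (67 ^ (s + 1)) :=
  ZMod.lift 67 ⟨zmultiplesHom _ ((67 ^ s : ℕ) : ZMod (67 ^ (s + 1))), by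
    simpa using mul_natCast_eq_zero s⟩

theorem inflate_natCast (n : ℕ) :
    inflate s n = ((67 ^ s * n : ℕ) : ZMod (67 ^ (s + 1))) := by
  have := ZMod.lift_coe 67 (⟨zmultiplesHom _ ((67 ^ s : ℕ) : ZMod (67 ^ (s + 1))), by
    simpa using mul_natCast_eq_zero s⟩ : { f : ℤ →+ ZMod (67 ^ (s + 1)) // f (67 : ℕ) = 0 }) n
  simp only [Int.cast_natCast] at this
  rw [inflate, this]
  simp [mul_comm]

theorem inflate_injective : Function.Injective (inflate s) := by
  rw [injective_iff_map_eq_zero]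
  intro a h
  rw [← ZMod.natCast_zmod_val a, inflate_natCast, ZMod.natCast_eq_zero_iff, pow_succ] at h
  have := Nat.dvd_of_mul_dvd_mul_left (by positivity) h
  rw [← ZMod.natCast_zmod_val a, ZMod.natCast_eq_zero_iff]
  exact this

theorem natCast_mem_range_inflate_iff (n : ℕ) :
    (n : ZMod (67 ^ (s + 1))) ∈ Set.range (inflate s) ↔ 67 ^ s ∣ n := by
  constructor
  · rintro ⟨a, ha⟩
    rw [← ZMod.natCast_zmod_val a, inflate_natCast, ZMod.natCast_eq_natCast_iff] at ha
    have := ha.of_dvd (pow_dvd_pow 67 (Nat.le_succ s))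
    exact (Nat.modEq_zero_iff_dvd.1 (this.symm.trans
      (Nat.modEq_zero_iff_dvd.2 (Nat.dvd_mul_right _ _))))
  · rintro ⟨c, rfl⟩
    exact ⟨c, inflate_natCast c⟩

theorem zmod67_cases (c : ZMod 67) : c = 0 ∨ ∃ i, c = 17 ^ i ∨ c = -17 ^ i := by
  have : ∀ c : ZMod 67, c = 0 ∨ ∃ i < 33, c = 17 ^ i ∨ c = -17 ^ i := by decide +kernel
  rcases this c with h | ⟨i, -, h⟩
  exacts [Or.inl h, Or.inr ⟨i, h⟩]

variable {O : Type} [CommRing O] {g : ZMod (67 ^ (s + 1)) → O} (hg : ∀ c, g (17 * c) = g c)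

include hg

omit [CommRing O] in
theorem apply_pow_mul (i : ℕ) (c : ZMod (67 ^ (s + 1))) : g (17 ^ i * c) = g c := by
  induction i with
  | zero => simp
  | succ i ih => rw [pow_succ' (17 : ZMod (67 ^ (s + 1))) i, mul_assoc, hg, ih]

omit [CommRing O] in
theorem apply_add_inflate_one {c : ZMod (67 ^ (s + 1))} (hc : c ∉ Set.range (inflate s)) :
    g (c + inflate s 1) = g c := by
  have h67 : inflate s 1 = ((67 ^ s : ℕ) : ZMod (67 ^ (s + 1))) := by
    simpa using inflate_natCast (s := s) 1
  rw [h67]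
  rw [← ZMod.natCast_zmod_val c] at hc ⊢
  rw [natCast_mem_range_inflate_iff] at hc
  obtain ⟨i, hi⟩ := exists_pow_mul_eq_add hc
  rw [← hi, apply_pow_mul hg]

omit [CommRing O] in
theorem apply_inflate_pow_mul (i : ℕ) (c : ZMod 67) :
    g (inflate s (17 ^ i * c)) = g (inflate s c) := by
  have : inflate s (17 ^ i * c) = 17 ^ i * inflate s c := by
    have := map_nsmul (inflate s) (17 ^ i) c
    simpa using this
  rw [this, apply_pow_mul hg]

omit [CommRing O] in
theorem apply_inflate_cases (c : ZMod 67) :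
    g (inflate s c) = g 0 ∨ g (inflate s c) = g (inflate s 1) ∨
      g (inflate s c) = g (inflate s (-1)) := by
  rcases zmod67_cases c with rfl | ⟨i, rfl | rfl⟩
  · simp
  · exact Or.inr (Or.inl (by simpa using apply_inflate_pow_mul hg i 1))
  · exact Or.inr (Or.inr (by simpa using apply_inflate_pow_mul hg i (-1)))

/-- The quadratic character of `ZMod 67` with values in `O`. -/
abbrev quadChar67 (O : Type) [CommRing O] : MulChar (ZMod 67) O :=
  (quadraticChar (ZMod 67)).ringHomComp (Int.castRingHom O)

omit hg in
theorem quadChar67_seventeen : quadChar67 O 17 = 1 := by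
  have : quadraticChar (ZMod 67) 17 = 1 := by decide +kernel
  simp [quadChar67, MulChar.ringHomComp_apply, this]

omit hg in
theorem quadChar67_neg_one : quadChar67 O (-1) = -1 := by
  have : quadraticChar (ZMod 67) (-1) = -1 := by decide +kernel
  simp [quadChar67, MulChar.ringHomComp_apply, this]

theorem two_mul_apply_inflate (c : ZMod 67) :
    2 * g (inflate s c) = (g (inflate s 1) + g (inflate s (-1))) +
      (g (inflate s 1) - g (inflate s (-1))) * quadChar67 O c +
      if c = 0 then 2 * g 0 - g (inflate s 1) - g (inflate s (-1)) else 0 := by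
  rcases zmod67_cases c with rfl | ⟨i, rfl | rfl⟩
  · rw [if_pos rfl, map_zero, MulChar.map_zero]
    ring
  · have h := apply_inflate_pow_mul hg i 1
    rw [mul_one] at h
    rw [h, map_pow, quadChar67_seventeen, one_pow, if_neg (pow_ne_zero _ (by decide +kernel))]
    ring
  · have h := apply_inflate_pow_mul hg i (-1)
    rw [mul_neg_one] at h
    rw [h, neg_eq_neg_one_mul (17 ^ i), map_mul, map_pow, quadChar67_seventeen, quadChar67_neg_one, one_pow,
      if_neg (mul_ne_zero (by decide +kernel) (pow_ne_zero _ (by decide +kernel)))]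
    ring

variable [IsDomain O]

theorem sum_mul_eq_sum_inflate {e : AddChar (ZMod (67 ^ (s + 1))) O} (he : e (inflate s 1) ≠ 1) :
    ∑ c, e c * g c = ∑ c, e (inflate s c) * g (inflate s c) := by
  set A := ∑ c ∈ Finset.univ.filter (· ∉ Set.range (inflate s)), e c * g c with hA
  have h0 : A = 0 := by
    have h1 : A = e (inflate s 1) * A := by
      rw [hA, Finset.mul_sum]
      symm
      refine Finset.sum_bij (fun c _ => c + inflate s 1) ?_ ?_ ?_ ?_
      · intro c hc
        rw [Finset.mem_filter] at hc ⊢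
        refine ⟨Finset.mem_univ _, ?_⟩
        rintro ⟨a, ha⟩
        exact hc.2 ⟨a - 1, by rw [map_sub, ha]; ring⟩
      · intro a _ b _ h
        exact add_right_cancel h
      · intro c hc
        rw [Finset.mem_filter] at hc
        refine ⟨c - inflate s 1, ?_, by ring⟩
        rw [Finset.mem_filter]
        refine ⟨Finset.mem_univ _, ?_⟩
        rintro ⟨a, ha⟩
        exact hc.2 ⟨a + 1, by rw [map_add, ha]; ring⟩
      · intro c hc
        rw [apply_add_inflate_one hg (Finset.mem_filter.1 hc).2, AddChar.map_add_eq_mul]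
        ring
    have h2 : (e (inflate s 1) - 1) * A = 0 := by rw [sub_mul, ← h1, one_mul, sub_self]
    exact (mul_eq_zero.1 h2).resolve_left (sub_ne_zero.2 he)
  rw [← Finset.sum_filter_add_sum_filter_not _ (· ∉ Set.range (inflate s)), ← hA, h0, zero_add]
  simp only [not_not]
  symm
  refine Finset.sum_bij (fun c _ => inflate s c) (by simp) (fun _ _ _ _ h => inflate_injective h)
    (fun c hc => ?_) (fun _ _ => rfl)
  obtain ⟨a, ha⟩ := (Finset.mem_filter.1 hc).2
  exact ⟨a, Finset.mem_univ _, ha⟩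

theorem two_mul_sum_eq {e : AddChar (ZMod (67 ^ (s + 1))) O} (he : e (inflate s 1) ≠ 1) :
    2 * ∑ c, e c * g c = (2 * g 0 - g (inflate s 1) - g (inflate s (-1))) +
      (g (inflate s 1) - g (inflate s (-1))) *
        gaussSum (quadChar67 O) (e.compAddMonoidHom (inflate s)) := by
  have hne : e.compAddMonoidHom (inflate s) ≠ 1 := fun h => he (by
    simpa using DFunLike.congr_fun h 1)
  rw [sum_mul_eq_sum_inflate hg he, Finset.mul_sum]
  have : ∀ c ∈ (Finset.univ : Finset (ZMod 67)), 2 * (e (inflate s c) * g (inflate s c)) =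
      (g (inflate s 1) + g (inflate s (-1))) * e.compAddMonoidHom (inflate s) c +
      (g (inflate s 1) - g (inflate s (-1))) *
        (quadChar67 O c * e.compAddMonoidHom (inflate s) c) +
      if c = 0 then 2 * g 0 - g (inflate s 1) - g (inflate s (-1)) else 0 := by
    intro c _
    rw [mul_left_comm, two_mul_apply_inflate hg, AddChar.compAddMonoidHom_apply]
    split_ifs with h
    · subst h
      simp
    · ring
  rw [Finset.sum_congr rfl this, Finset.sum_add_distrib, Finset.sum_add_distrib, ← Finset.mul_sum,
    ← Finset.mul_sum, AddChar.sum_eq_zero_of_ne_one hne, ← gaussSum, Finset.sum_ite_eq']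
  simp [add_comm]

omit [IsDomain O] in
/-- The sums of `g` over windows of length `67 ^ s` take at most three values. -/
theorem window_sum_cases : ∃ K : O, ∀ c : ZMod (67 ^ (s + 1)), ∃ a : ZMod 67,
    ∑ i ∈ Finset.range (67 ^ s), g (c + i) = K + g (inflate s a) := by
  set T : ℕ → O := fun n => ∑ i ∈ Finset.range (67 ^ s), g ((n + i : ℕ) : ZMod (67 ^ (s + 1)))
  have hpos : 0 < 67 ^ s := by positivity
  have hstep : ∀ n, T (n + 1) + g (n : ZMod (67 ^ (s + 1))) =
      T n + g ((n + 67 ^ s : ℕ) : ZMod (67 ^ (s + 1))) := by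
    intro n
    have h1 := Finset.sum_range_succ (fun i => g ((n + i : ℕ) : ZMod (67 ^ (s + 1)))) (67 ^ s)
    rw [Finset.sum_range_succ'] at h1
    rw [← h1, add_zero]
    congr 1
    exact Finset.sum_congr rfl fun i _ => by rw [add_right_comm, add_assoc]
  have hT : ∀ n, T (n + 1) = (T 1 - g (inflate s 1)) + g (inflate s ((n / 67 ^ s + 1 : ℕ))) := by
    intro n
    induction n with
    | zero => simp
    | succ n ih =>
      have h2 := hstep (n + 1)
      rw [Nat.succ_div]
      split_ifs with h
      · obtain ⟨k, hk⟩ := h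
        have hk' : n / 67 ^ s + 1 = k := by
          have := Nat.succ_div_of_dvd (a := n) (b := 67 ^ s) ⟨k, hk⟩
          rw [← this, hk, Nat.mul_div_cancel_left _ hpos]
        have hk2 : (n + 1 + 67 ^ s : ℕ) = 67 ^ s * (k + 1) := by rw [mul_add, mul_one, ← hk]
        rw [hk', inflate_natCast, ← hk] at ih
        rw [hk', inflate_natCast, ← hk2]
        linear_combination h2 + ih
      · have h3 := apply_add_inflate_one hg
          (fun h' => h ((natCast_mem_range_inflate_iff (n + 1)).1 h'))
        have h67 : inflate s 1 = ((67 ^ s : ℕ) : ZMod (67 ^ (s + 1))) := by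
          simpa using inflate_natCast (s := s) 1
        rw [h67, ← Nat.cast_add] at h3
        rw [h3] at h2
        rw [add_zero, ← ih]
        exact add_right_cancel h2
  refine ⟨T 1 - g (inflate s 1), fun c =>
    ⟨((c.val + (67 ^ (s + 1) - 1)) / 67 ^ s + 1 : ℕ), ?_⟩⟩
  rw [← hT]
  refine Finset.sum_congr rfl fun i _ => ?_
  rw [Nat.cast_add, add_assoc c.val, Nat.sub_add_cancel (Nat.one_le_pow _ _ (by norm_num)),
    Nat.cast_add, ZMod.natCast_self, add_zero, ZMod.natCast_zmod_val]

end ClassSums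
section ClassSum

variable {F : Type} [Field F] [Fintype F] {N : ℕ} {O : Type} [CommRing O]

/-- The sum of `ψ` over the units of class `c` with respect to `L`. -/
def classSum (L : Fˣ →* Multiplicative (ZMod N)) (ψ : AddChar F O) (c : ZMod N) : O :=
  ∑ x : Fˣ, if L x = Multiplicative.ofAdd c then ψ x else 0

variable (L : Fˣ →* Multiplicative (ZMod N)) (ψ : AddChar F O)

theorem gaussSum_eq_sum_classSum [NeZero N] {χ : MulChar F O} {e : AddChar (ZMod N) O}
    (h : ∀ x : Fˣ, χ x = e (L x).toAdd) : gaussSum χ ψ = ∑ c, e c * classSum L ψ c := by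
  have h1 : gaussSum χ ψ = ∑ x : Fˣ, χ x * ψ x := by
    symm
    refine Finset.sum_of_injOn (fun x : Fˣ => (x : F)) (fun x _ y _ h => Units.ext h) (by simp)
      (fun x _ hx => ?_) (fun _ _ => rfl)
    have : x = 0 := by
      by_contra h0
      exact hx ⟨Units.mk0 x h0, by simp, rfl⟩
    rw [this, MulChar.map_zero, zero_mul]
  simp only [h1, classSum, Finset.mul_sum]
  rw [Finset.sum_comm]
  refine Finset.sum_congr rfl fun x _ => ?_
  rw [Finset.sum_eq_single (L x).toAdd]
  · rw [if_pos (by simp), h]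
  · intro c _ hc
    rw [if_neg, mul_zero]
    rintro h
    exact hc (by rw [h, toAdd_ofAdd])
  · simp

theorem classSum_natCast_mul {p : ℕ} [Fact p.Prime] [CharP F p] (hp : p.Coprime N)
    (hψ : ∀ x, ψ (x ^ p) = ψ x) (c : ZMod N) : classSum L ψ (p * c) = classSum L ψ c := by
  have hbij : Function.Bijective (fun x : Fˣ => x ^ p) := by
    refine Finite.injective_iff_bijective.1 fun x y h => Units.ext (frobenius_inj F p ?_)
    simpa [frobenius_def] using congrArg Units.val h
  rw [classSum, ← hbij.sum_comp]
  refine Finset.sum_congr rfl fun x _ => ?_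
  rw [Units.val_pow_eq_pow_val, hψ, map_pow]
  refine if_congr ?_ rfl rfl
  rw [← Multiplicative.toAdd.injective.eq_iff, ← Multiplicative.toAdd.injective.eq_iff,
    toAdd_pow, nsmul_eq_mul, toAdd_ofAdd, toAdd_ofAdd]
  exact ((ZMod.isUnit_iff_coprime p N).2 hp).mul_right_inj

variable {p : ℕ} [Fact p.Prime] [Algebra (ZMod p) F]

omit [Fintype F] in
theorem map_algebraMap_eq_one (hp : (p - 1).Coprime N) (u : (ZMod p)ˣ) :
    L (Units.map (algebraMap (ZMod p) F).toMonoidHom u) = 1 := by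
  have h : (p - 1) • (L (Units.map (algebraMap (ZMod p) F).toMonoidHom u)).toAdd = 0 := by
    rw [← toAdd_pow, ← map_pow, ← map_pow, ZMod.units_pow_card_sub_one_eq_one, map_one, map_one,
      toAdd_one]
  rw [nsmul_eq_mul] at h
  exact Multiplicative.toAdd.injective
    (((ZMod.isUnit_iff_coprime (p - 1) N).2 hp).mul_right_eq_zero.1 h)

omit [Fintype F] in
theorem map_neg_one_eq_one (hp : (p - 1).Coprime N) : L (-1) = 1 := by
  have := map_algebraMap_eq_one (F := F) L hp (-1)
  rwa [show Units.map (algebraMap (ZMod p) F).toMonoidHom (-1) = -1 by ext; simp] at this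

omit [Fintype F] in
theorem exists_intCast_eq_sum_traceChar {ζ : PadicAlgInt p} (hζ : IsPrimitiveRoot ζ p) (x : F) :
    ∃ n : ℤ, (n : PadicAlgInt p) =
      ∑ u : (ZMod p)ˣ, PadicAlgInt.traceChar F hζ (algebraMap (ZMod p) F u * x) := by
  have h1 : ∀ u : ZMod p, PadicAlgInt.traceChar F hζ (algebraMap (ZMod p) F u * x) =
      AddChar.zmodChar p hζ.pow_eq_one (u * Algebra.trace (ZMod p) F x) := fun u => by
    rw [PadicAlgInt.traceChar_apply, AddChar.zmodChar_apply, ← Algebra.smul_def, map_smul,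
      smul_eq_mul]
  have h2 := AddChar.sum_mulShift (Algebra.trace (ZMod p) F x)
    (AddChar.zmodChar_primitive_of_primitive_root p hζ)
  refine ⟨(if Algebra.trace (ZMod p) F x = 0 then p else 0) - 1, ?_⟩
  have h3 : ∑ u : (ZMod p)ˣ, PadicAlgInt.traceChar F hζ (algebraMap (ZMod p) F u * x) =
      ∑ u ∈ Finset.univ.erase (0 : ZMod p),
        AddChar.zmodChar p hζ.pow_eq_one (u * Algebra.trace (ZMod p) F x) := by
    refine Finset.sum_of_injOn (fun x : (ZMod p)ˣ => (x : ZMod p)) (fun x _ y _ h => Units.ext h)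
      (by intro u _; simp) (fun x hx hx' => ?_) (fun u _ => h1 u)
    exact absurd ⟨Units.mk0 x (Finset.ne_of_mem_erase hx), by simp, rfl⟩ hx'
  rw [h3, Finset.sum_erase_eq_sub (Finset.mem_univ _), h2, zero_mul, AddChar.map_zero_eq_one,
    ZMod.card]
  split_ifs <;> simp

theorem exists_intCast_eq_mul_classSum {ζ : PadicAlgInt p} (hζ : IsPrimitiveRoot ζ p)
    (hp : (p - 1).Coprime N) (c : ZMod N) :
    ∃ n : ℤ, (n : PadicAlgInt p) =
      (p - 1 : ℕ) * classSum L (PadicAlgInt.traceChar F hζ) c := by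
  have h1 : ((p - 1 : ℕ) : PadicAlgInt p) * classSum L (PadicAlgInt.traceChar F hζ) c =
      ∑ x : Fˣ, if L x = Multiplicative.ofAdd c then
        ∑ u : (ZMod p)ˣ, PadicAlgInt.traceChar F hζ (algebraMap (ZMod p) F u * x) else 0 := by
    have h2 : ∀ u : (ZMod p)ˣ, classSum L (PadicAlgInt.traceChar F hζ) c =
        ∑ x : Fˣ, if L x = Multiplicative.ofAdd c then
          PadicAlgInt.traceChar F hζ (algebraMap (ZMod p) F u * x) else 0 := fun u => by
      rw [classSum, ← (Equiv.mulLeft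
        (Units.map (algebraMap (ZMod p) F).toMonoidHom u)).bijective.sum_comp]
      refine Finset.sum_congr rfl fun x _ => ?_
      rw [Equiv.coe_mulLeft, map_mul, map_algebraMap_eq_one L hp, one_mul]
      rfl
    have h3 := Finset.sum_congr (rfl : (Finset.univ : Finset (ZMod p)ˣ) = _) fun u _ => h2 u
    rw [Finset.sum_const, Finset.card_univ, ZMod.card_units, nsmul_eq_mul] at h3
    rw [h3, Finset.sum_comm]
    refine Finset.sum_congr rfl fun x _ => ?_
    split_ifs <;> simp
  choose n hn using fun x : F => exists_intCast_eq_sum_traceChar hζ x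
  refine ⟨∑ x : Fˣ, if L x = Multiplicative.ofAdd c then n x else 0, ?_⟩
  rw [h1, Int.cast_sum]
  refine Finset.sum_congr rfl fun x _ => ?_
  rw [← hn]
  split_ifs <;> simp

end ClassSum
section KeyIdentity

theorem eq_or_eq_neg_of_sq_add {B C : ℤ} {r : ℕ} (h : B ^ 2 + 67 * C ^ 2 = 1024 * 17 ^ (2 * r + 1))
    (hB : 17 ^ r ∣ B) (hC : 17 ^ r ∣ C) : B = C ∨ B = -C := by
  obtain ⟨b, rfl⟩ := hB
  obtain ⟨c, rfl⟩ := hC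
  have h1 : b ^ 2 + 67 * c ^ 2 = 17408 := by
    have h0 : ((17 : ℤ) ^ r) ^ 2 ≠ 0 := by positivity
    apply mul_left_cancel₀ h0
    rw [pow_succ 17, pow_mul'] at h
    linear_combination h
  have hc : |c| < 17 := abs_lt_of_sq_lt_sq (by linarith [sq_nonneg b]) (by norm_num)
  have hcases : ∀ n ≤ 16, ∀ m ≤ 131, m ^ 2 + 67 * n ^ 2 = 17408 → m = n := by decide +kernel
  have hb : |b| < 132 := abs_lt_of_sq_lt_sq (by linarith [sq_nonneg c]) (by norm_num)
  have habs : b.natAbs = c.natAbs := by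
    rw [Int.abs_eq_natAbs] at hb hc
    refine hcases _ (by omega) _ (by omega) ?_
    zify
    simpa using h1
  rcases Int.natAbs_eq_natAbs_iff.1 habs with rfl | rfl
  · exact Or.inl rfl
  · exact Or.inr (by ring)

theorem le_pow_of_mul_eq {a b t : ℝ≥0} {r : ℕ} (ht : 0 < t) (h : a * b = t ^ (2 * r + 1))
    (hb : t ^ (r + 1) ≤ b) : a ≤ t ^ r := by
  refine le_of_mul_le_mul_right ?_ (pow_pos ht (r + 1))
  calc a * t ^ (r + 1) ≤ a * b := mul_le_mul_right hb a
    _ = t ^ r * t ^ (r + 1) := by rw [h]; ring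

instance : Fact (Nat.Prime 17) := ⟨by norm_num⟩

open PadicAlgInt

variable {s : ℕ} {F : Type} [Field F] [Fintype F] [Algebra (ZMod 17) F]
  {L : Fˣ →* Multiplicative (ZMod (67 ^ (s + 1)))} {γ : Fˣ} {ζ : PadicAlgInt 17}

theorem inv_pow_le_val_of_sum_le {σ : F →+* Residue 17} {ω : MulChar F (PadicAlgInt 17)}
    (hω : ∀ x, red 17 (ω x) = σ x) (hζ : IsPrimitiveRoot ζ 17)
    (hF : Fintype.card F = 17 ^ (33 * 67 ^ s)) {k t r : ℕ} (hr : 33 * 67 ^ s = 2 * r + 1)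
    (hk : Fintype.card F = 67 ^ (s + 1) * k + 1) (h1 : 1 < Fintype.card F - 1)
    (ht : t < 67 ^ (s + 1))
    (hsum : ∑ j ∈ Finset.range (33 * 67 ^ s), 17 * (17 ^ j * t % 67 ^ (s + 1)) / 67 ^ (s + 1) ≤
      8 * (33 * 67 ^ s + 1)) :
    (17 : ℝ≥0)⁻¹ ^ (r + 1) ≤ val 17 (gaussSum (ω⁻¹ ^ (k * t)) (traceChar F hζ)) := by
  have hdiv : 17 ^ (33 * 67 ^ s) * t / 67 ^ (s + 1) = k * t := by
    rw [← hF, hk, add_mul, one_mul, mul_assoc, Nat.mul_add_div (by positivity),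
      Nat.div_eq_of_lt ht, add_zero]
  have hlt : k * t < Fintype.card F - 1 := by
    rw [hk, Nat.add_sub_cancel, mul_comm]
    refine Nat.mul_lt_mul_of_pos_right ht ?_
    by_contra h0
    rw [Nat.eq_zero_of_not_pos h0] at hk
    omega
  have h2 := val_sub_one_pow_sum_le hω hζ h1 ht (J := 33 * 67 ^ s) (by rwa [hdiv])
  rw [hdiv] at h2
  refine le_trans ?_ h2
  have h3 := inv_le_val_sub_one_pow 17 hζ
  calc (17 : ℝ≥0)⁻¹ ^ (r + 1) ≤ (val 17 (ζ - 1) ^ (17 - 1)) ^ (r + 1) :=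
        pow_le_pow_left' (by exact_mod_cast h3) _
    _ = val 17 (ζ - 1) ^ (8 * (33 * 67 ^ s + 1)) := by
        rw [← pow_mul, hr]
        congr 1
        ring
    _ ≤ _ := pow_le_pow_right_of_le_one' (val_le_one 17 _) hsum

/-- The Gauss sum of a character of order `67 ^ (s + 1)` has bounded valuation, as does that of
the inverse character. -/
theorem exists_addChar_val_sum (hF : Fintype.card F = 17 ^ (33 * 67 ^ s))
    (hγ : ∀ x, x ∈ Subgroup.zpowers γ) (hL : L γ = Multiplicative.ofAdd 1)
    (hζ : IsPrimitiveRoot ζ 17) {r : ℕ} (hr : 33 * 67 ^ s = 2 * r + 1) :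
    ∃ e : AddChar (ZMod (67 ^ (s + 1))) (PadicAlgInt 17), e (inflate s 1) ≠ 1 ∧
      (17 : ℝ≥0)⁻¹ ^ (r + 1) ≤ val 17 (∑ c, e c * classSum L (traceChar F hζ) c) ∧
      (17 : ℝ≥0)⁻¹ ^ (r + 1) ≤ val 17 (∑ c, e⁻¹ c * classSum L (traceChar F hζ) c) ∧
      (∑ c, e c * classSum L (traceChar F hζ) c) * (∑ c, e⁻¹ c * classSum L (traceChar F hζ) c) =
        17 ^ (33 * 67 ^ s) := by
  obtain ⟨σ, ω, hω⟩ := exists_teichmuller 17 F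
  have hdvd := (pow_dvd_pow_sub_one_iff s _).2 (dvd_refl (33 * 67 ^ s))
  rw [← hF] at hdvd
  obtain ⟨k, hk⟩ := hdvd
  have hbig : 17 ^ 1 ≤ Fintype.card F := by
    rw [hF]
    exact Nat.pow_le_pow_right (by norm_num) (by omega)
  have h1 : 1 < Fintype.card F - 1 := by omega
  have hk' : Fintype.card F = 67 ^ (s + 1) * k + 1 := by omega
  have hk0 : 0 < k := by
    by_contra h0
    rw [Nat.eq_zero_of_not_pos h0] at hk
    omega
  have hN : 1 < 67 ^ (s + 1) := Nat.one_lt_pow (Nat.succ_ne_zero s) (by norm_num)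
  set χ : MulChar F (PadicAlgInt 17) := ω⁻¹ ^ k with hχ
  have hχN : χ ^ 67 ^ (s + 1) = 1 := by
    rw [hχ, ← pow_mul, mul_comm, ← hk, ← Fintype.card_units, MulChar.pow_card_eq_one]
  have hξ : χ γ ^ 67 ^ (s + 1) = 1 := by
    rw [← MulChar.pow_apply_coe, hχN, MulChar.one_apply_coe]
  set e := AddChar.zmodChar (67 ^ (s + 1)) hξ with he
  have hχe : ∀ x : Fˣ, χ x = e (L x).toAdd := by
    intro x
    obtain ⟨n, rfl⟩ := mem_powers_iff_mem_zpowers.2 (hγ x)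
    simp only [map_pow, Units.val_pow_eq_pow_val, hL, toAdd_pow, toAdd_ofAdd, nsmul_one]
    rw [he, AddChar.zmodChar_apply']
  have hχe' : ∀ x : Fˣ, χ⁻¹ x = e⁻¹ (L x).toAdd := by
    intro x
    rw [MulChar.inv_apply, Ring.inverse_unit, hχe, map_inv, AddChar.inv_apply, toAdd_inv]
  have hinv : ω⁻¹ ^ (k * (67 ^ (s + 1) - 1)) = χ⁻¹ := by
    rw [pow_mul, ← hχ, eq_inv_iff_mul_eq_one, ← pow_succ, Nat.sub_add_cancel hN.le, hχN]
  refine ⟨e, ?_, ?_, ?_, ?_⟩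
  · have h67 : inflate s 1 = ((67 ^ s : ℕ) : ZMod (67 ^ (s + 1))) := by
      simpa using inflate_natCast (s := s) 1
    rw [h67, he, AddChar.zmodChar_apply', ← MulChar.pow_apply_coe, hχ, ← pow_mul]
    intro h
    refine teichmuller_inv_pow_ne_one hω (n := k * 67 ^ s) (by positivity) ?_
      ((MulChar.eq_iff hγ _ _).2 (by rw [h, MulChar.one_apply_coe]))
    rw [hk, mul_comm]
    exact Nat.mul_lt_mul_of_pos_right (Nat.pow_lt_pow_right (by norm_num) (Nat.lt_succ_self s)) hk0
  · rw [← gaussSum_eq_sum_classSum L _ hχe]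
    have := inv_pow_le_val_of_sum_le hω hζ hF hr hk' h1 hN (sum_digits_one_le s)
    rwa [mul_one] at this
  · rw [← gaussSum_eq_sum_classSum L _ hχe', ← hinv]
    exact inv_pow_le_val_of_sum_le hω hζ hF hr hk' h1
      (Nat.sub_lt (by omega) one_pos) (sum_digits_neg_one_le s)
  · rw [← gaussSum_eq_sum_classSum L _ hχe, ← gaussSum_eq_sum_classSum L _ hχe']
    have hne : χ ≠ 1 := teichmuller_inv_pow_ne_one hω hk0 (by
      rw [hk]
      exact lt_mul_of_one_lt_left hk0 hN)
    have h2 := gaussSum_mul_gaussSum_eq_card hne (traceChar_isPrimitive (F := F) hζ)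
    have h3 := mul_gaussSum_inv_eq_gaussSum χ⁻¹ (traceChar F hζ)
    have h4 := hχe' (-1)
    rw [map_neg_one_eq_one (p := 17) L (Nat.Coprime.pow_right _ (by norm_num)), toAdd_one,
      AddChar.map_zero_eq_one, Units.val_neg, Units.val_one] at h4
    rw [h4, one_mul] at h3
    rw [← h3, h2, hF]
    push_cast
    rfl

/-- Two of the three inflated class sums coincide. -/
theorem classSum_zero_eq (hF : Fintype.card F = 17 ^ (33 * 67 ^ s))
    (hγ : ∀ x, x ∈ Subgroup.zpowers γ) (hL : L γ = Multiplicative.ofAdd 1)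
    (hζ : IsPrimitiveRoot ζ 17) :
    classSum L (traceChar F hζ) 0 = classSum L (traceChar F hζ) (inflate s 1) ∨
    classSum L (traceChar F hζ) 0 = classSum L (traceChar F hζ) (inflate s (-1)) := by
  obtain ⟨r, hr⟩ : Odd (33 * 67 ^ s) := Odd.mul (by decide) (Odd.pow (by decide))
  obtain ⟨e, he, hv1, hv2, hmul⟩ := exists_addChar_val_sum hF hγ hL hζ hr
  have : CharP F 17 := charP_of_injective_algebraMap' (ZMod 17) 17
  have hg : ∀ c, classSum L (traceChar F hζ) (17 * c) = classSum L (traceChar F hζ) c :=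
    classSum_natCast_mul L (traceChar F hζ) (p := 17)
      (Nat.Coprime.pow_right _ (by norm_num)) (traceChar_pow hζ)
  have he' : e⁻¹ (inflate s 1) ≠ 1 := by
    intro h
    have h1 : e (inflate s 1) * e⁻¹ (inflate s 1) = 1 := by
      rw [← AddChar.mul_apply, mul_inv_cancel, AddChar.one_apply]
    rw [h, mul_one] at h1
    exact he h1
  choose n hn using exists_intCast_eq_mul_classSum L hζ
    (Nat.Coprime.pow_right (s + 1) (by norm_num : Nat.Coprime (17 - 1) 67))
  generalize classSum L (traceChar F hζ) = g at *
  have hS1 := two_mul_sum_eq hg he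
  have hS2 := two_mul_sum_eq hg he'
  have hneg : gaussSum (quadChar67 (PadicAlgInt 17)) (e⁻¹.compAddMonoidHom (inflate s)) =
      -gaussSum (quadChar67 (PadicAlgInt 17)) (e.compAddMonoidHom (inflate s)) := by
    have := mul_gaussSum_inv_eq_gaussSum (quadChar67 (PadicAlgInt 17))
      (e.compAddMonoidHom (inflate s))
    rw [quadChar67_neg_one] at this
    rw [← this, neg_one_mul, neg_neg]
    congr 1
    ext x
    simp [AddChar.inv_apply]
  have hsq : gaussSum (quadChar67 (PadicAlgInt 17)) (e.compAddMonoidHom (inflate s)) ^ 2 = -67 := by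
    rw [gaussSum_sq, quadChar67_neg_one, ZMod.card]
    · simp
    · intro h
      have h1 := quadChar67_neg_one (O := PadicAlgInt 17)
      rw [h] at h1
      have h2 : (1 : MulChar (ZMod 67) (PadicAlgInt 17)) (-1) = 1 :=
        MulChar.one_apply isUnit_one.neg
      rw [h2] at h1
      exact absurd h1.symm (by norm_num)
    · exact (quadraticChar_isQuadratic (ZMod 67)).comp _
    · refine AddChar.IsPrimitive.of_ne_one fun h => he ?_
      simpa using DFunLike.congr_fun h 1
  rw [hneg] at hS2
  set S1 := ∑ c, e c * g c
  set S2 := ∑ c, e⁻¹ c * g c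
  set g₂ := gaussSum (quadChar67 (PadicAlgInt 17)) (e.compAddMonoidHom (inflate s))
  obtain ⟨B, hB⟩ : ∃ B : ℤ, (B : PadicAlgInt 17) =
      16 * (2 * g 0 - g (inflate s 1) - g (inflate s (-1))) :=
    ⟨2 * n 0 - n (inflate s 1) - n (inflate s (-1)), by
      push_cast [hn]
      norm_num
      ring⟩
  obtain ⟨C, hC⟩ : ∃ C : ℤ, (C : PadicAlgInt 17) = 16 * (g (inflate s 1) - g (inflate s (-1))) :=
    ⟨n (inflate s 1) - n (inflate s (-1)), by
      push_cast [hn]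
      norm_num
      ring⟩
  have h2 : (2 : PadicAlgInt 17) ≠ 0 := two_ne_zero
  have hBS : (B : PadicAlgInt 17) = 16 * (S1 + S2) := by
    apply mul_left_cancel₀ h2
    rw [hB]
    linear_combination (-16) * hS1 - 16 * hS2
  have hCS : ((67 * C : ℤ) : PadicAlgInt 17) = -16 * g₂ * (S1 - S2) := by
    apply mul_left_cancel₀ h2
    push_cast
    rw [hC]
    linear_combination 16 * g₂ * (hS1 - hS2) + 32 * (g (inflate s 1) - g (inflate s (-1))) * hsq
  have hval : val 17 S1 * val 17 S2 = (17 : ℝ≥0)⁻¹ ^ (2 * r + 1) := by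
    rw [← map_mul, hmul, map_pow, hr]
    congr 1
    exact_mod_cast val_natCast_self 17
  have hv1' := le_pow_of_mul_eq (by norm_num) hval hv2
  have hv2' := le_pow_of_mul_eq (by norm_num) ((mul_comm _ _).trans hval) hv1
  have hBd : (17 : ℤ) ^ r ∣ B := by
    refine (val_intCast_le_iff 17 B r).1 ?_
    rw [hBS, map_mul]
    exact (mul_le_of_le_one_left' (val_le_one 17 _)).trans
      ((Valuation.map_add _ _ _).trans (max_le hv1' hv2'))
  have hCd : (17 : ℤ) ^ r ∣ C := by
    refine IsCoprime.dvd_of_dvd_mul_left (y := 67) (IsCoprime.pow_left (by norm_num)) ?_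
    refine (val_intCast_le_iff 17 _ r).1 ?_
    rw [hCS, map_mul]
    exact (mul_le_of_le_one_left' (val_le_one 17 _)).trans
      ((Valuation.map_sub _ _ _).trans (max_le hv1' hv2'))
  have hBC : B ^ 2 + 67 * C ^ 2 = 1024 * 17 ^ (2 * r + 1) := by
    have : ((B ^ 2 + 67 * C ^ 2 : ℤ) : PadicAlgInt 17) = (1024 * 17 ^ (2 * r + 1) : ℤ) := by
      push_cast
      rw [← hr, ← hmul, hB, hC]
      linear_combination (-256) * (2 * S2) * hS1 -
        256 * (2 * g 0 - g (inflate s 1) - g (inflate s (-1)) +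
          (g (inflate s 1) - g (inflate s (-1))) * g₂) * hS2 +
        256 * (g (inflate s 1) - g (inflate s (-1))) ^ 2 * hsq
    exact_mod_cast this
  have h32 : (32 : PadicAlgInt 17) ≠ 0 := by norm_num
  rcases eq_or_eq_neg_of_sq_add hBC hBd hCd with h | h
  · left
    apply mul_left_cancel₀ h32
    rw [h] at hB
    linear_combination hC - hB
  · right
    apply mul_left_cancel₀ h32
    rw [h, Int.cast_neg] at hB
    linear_combination -hC - hB

end KeyIdentity
section CayleySRG

variable {F : Type} [Field F] [Fintype F] {S : Finset F}

theorem sum_addChar_mul_sub {O : Type} [CommRing O] [IsDomain O] {ψ : AddChar F O}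
    (hψ : ψ.IsPrimitive) (d x : F) :
    ∑ a, ψ (a * x) * ψ (-(a * d)) = if x = d then (Fintype.card F : O) else 0 := by
  have h := AddChar.sum_mulShift (x - d) hψ
  simpa [sub_eq_zero, Nat.cast_ite, mul_sub, ← AddChar.map_add_eq_mul, ← sub_eq_add_neg] using h

/-- If the nontrivial eigenvalues of a Cayley graph on `F` are roots of `X ^ 2 - (α + β) X + α β`,
this determines the numbers of representations as a sum of two elements of `S`. -/
theorem card_mul_card_filter_sub_mem {O : Type} [CommRing O] [IsDomain O] {ψ : AddChar F O}
    (hψ : ψ.IsPrimitive) {α β : O}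
    (hS : ∀ a ≠ 0, ∑ x ∈ S, ψ (a * x) = α ∨ ∑ x ∈ S, ψ (a * x) = β) {d : F} (hd : d ≠ 0) :
    (Fintype.card F : O) * (S.filter (d - · ∈ S)).card =
      (if d ∈ S then (α + β) * Fintype.card F else 0) + (S.card - α) * (S.card - β) := by
  have h1 : ∀ a, (∑ x ∈ S, ψ (a * x)) * (∑ y ∈ S, ψ (a * y)) =
      (α + β) * (∑ x ∈ S, ψ (a * x)) - α * β + if a = 0 then (S.card - α) * (S.card - β) else 0 := by
    intro a
    by_cases ha : a = 0
    · subst ha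
      simp
      ring
    · rw [if_neg ha]
      rcases hS a ha with h | h <;> rw [h] <;> ring
  have h2 : ∑ a, (∑ x ∈ S, ψ (a * x)) * (∑ y ∈ S, ψ (a * y)) * ψ (-(a * d)) =
      (Fintype.card F : O) * (S.filter (d - · ∈ S)).card := by
    calc _ = ∑ x ∈ S, ∑ y ∈ S, ∑ a, ψ (a * (x + y)) * ψ (-(a * d)) := by
          simp only [Finset.sum_mul]
          rw [Finset.sum_comm]
          refine Finset.sum_congr rfl fun x _ => ?_
          rw [Finset.sum_comm]
          simp only [mul_add, AddChar.map_add_eq_mul, Finset.mul_sum, Finset.sum_mul]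
      _ = ∑ x ∈ S, ∑ y ∈ S, if y = d - x then (Fintype.card F : O) else 0 := by
          simp only [sum_addChar_mul_sub hψ, eq_sub_iff_add_eq']
      _ = _ := by
          simp only [Finset.sum_ite_eq']
          rw [← Finset.sum_filter, Finset.sum_const, nsmul_eq_mul, mul_comm]
  have h3 : ∑ a, (∑ x ∈ S, ψ (a * x)) * ψ (-(a * d)) = if d ∈ S then (Fintype.card F : O) else 0 := by
    simp only [Finset.sum_mul]
    rw [Finset.sum_comm]
    simp only [sum_addChar_mul_sub hψ, Finset.sum_ite_eq']
  have h4 : ∑ a, ψ (-(a * d)) = 0 := by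
    have := sum_addChar_mul_sub hψ d 0
    simpa [hd.symm] using this
  rw [← h2]
  simp only [h1, add_mul, sub_mul, Finset.sum_add_distrib, Finset.sum_sub_distrib, mul_assoc,
    ← Finset.mul_sum, h3, h4, ite_mul, zero_mul, Finset.sum_ite_eq', Finset.mem_univ, if_true]
  simp only [← sub_mul, ← add_mul, AddChar.map_zero_eq_one, neg_zero]
  split_ifs <;> ring

theorem exists_forall_eq_of_forall_eq {α β : Type} [Nonempty β] {P : α → Prop} {c : α → β}
    (h : ∀ a b, P a → P b → c a = c b) : ∃ l, ∀ a, P a → c a = l := by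
  by_cases hP : ∃ a, P a
  · obtain ⟨a, ha⟩ := hP
    exact ⟨c a, fun b hb => h b a hb ha⟩
  · exact ⟨Classical.arbitrary β, fun a ha => absurd ⟨a, ha⟩ hP⟩

theorem fromRel_sub_mem_isSRGWith (h0 : (0 : F) ∉ S) (hneg : ∀ x ∈ S, -x ∈ S)
    {O : Type} [CommRing O] [IsDomain O] [CharZero O] {ψ : AddChar F O} (hψ : ψ.IsPrimitive)
    {α β : O} (hS : ∀ a ≠ 0, ∑ x ∈ S, ψ (a * x) = α ∨ ∑ x ∈ S, ψ (a * x) = β) :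
    ∃ l u : ℕ, (SimpleGraph.fromRel fun x y : F => x - y ∈ S).IsSRGWith
      (Fintype.card F) S.card l u := by
  have hadj : ∀ x y, (SimpleGraph.fromRel fun x y : F => x - y ∈ S).Adj x y ↔ x - y ∈ S := by
    intro x y
    rw [SimpleGraph.fromRel_adj]
    constructor
    · rintro ⟨-, h | h⟩
      · exact h
      · rw [← neg_sub]
        exact hneg _ h
    · intro h
      exact ⟨by rintro rfl; exact h0 (by rwa [sub_self] at h), Or.inl h⟩
  have hq : (Fintype.card F : O) ≠ 0 := Nat.cast_ne_zero.2 Fintype.card_ne_zero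
  have hkey : ∀ d d' : F, d ≠ 0 → d' ≠ 0 → (d ∈ S ↔ d' ∈ S) →
      (S.filter (d - · ∈ S)).card = (S.filter (d' - · ∈ S)).card := by
    intro d d' hd hd' h
    have h1 := card_mul_card_filter_sub_mem hψ hS hd
    have h2 := card_mul_card_filter_sub_mem hψ hS hd'
    rw [← if_congr h rfl rfl, ← h1] at h2
    exact_mod_cast (mul_left_cancel₀ hq h2).symm
  have hcommon : ∀ v w, Fintype.card
      ((SimpleGraph.fromRel fun x y : F => x - y ∈ S).commonNeighbors v w) =
      (S.filter (v - w - · ∈ S)).card := by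
    intro v w
    rw [← Fintype.card_of_subtype (p := fun x => x ∈ S ∧ v - w - x ∈ S) _ (fun x => by simp)]
    refine Fintype.card_congr (Equiv.subtypeEquiv (Equiv.subLeft v) fun z => ?_)
    rw [SimpleGraph.mem_commonNeighbors, hadj, hadj, Equiv.subLeft_apply]
    refine and_congr_right fun _ => ?_
    rw [show v - w - (v - z) = -(w - z) by ring]
    exact ⟨hneg _, fun h => by simpa using hneg _ h⟩
  obtain ⟨l, hl⟩ := exists_forall_eq_of_forall_eq (P := fun d => d ∈ S)
    (c := fun d => (S.filter (d - · ∈ S)).card) fun d d' hd hd' =>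
      hkey d d' (by rintro rfl; exact h0 hd) (by rintro rfl; exact h0 hd') (iff_of_true hd hd')
  obtain ⟨u, hu⟩ := exists_forall_eq_of_forall_eq (P := fun d => d ≠ 0 ∧ d ∉ S)
    (c := fun d => (S.filter (d - · ∈ S)).card) fun d d' hd hd' =>
      hkey d d' hd.1 hd'.1 (iff_of_false hd.2 hd'.2)
  refine ⟨l, u, rfl, fun v => ?_, fun v w h => ?_, fun v w hne h => ?_⟩
  · rw [← SimpleGraph.card_neighborSet_eq_degree,
      ← Fintype.card_of_subtype (p := fun x => x ∈ S) S (fun x => Iff.rfl)]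
    refine Fintype.card_congr (Equiv.subtypeEquiv (Equiv.subLeft v) fun z => ?_)
    rw [SimpleGraph.mem_neighborSet, hadj, Equiv.subLeft_apply]
  · rw [hcommon]
    exact hl _ ((hadj v w).1 h)
  · rw [hcommon]
    exact hu _ ⟨sub_ne_zero.2 hne, fun h' => h ((hadj v w).2 h')⟩

end CayleySRG
section Windows

variable {F : Type} [Field F] [Fintype F] {N : ℕ}

/-- The set of the units whose class with respect to `L` is one of `c, c + 1, …, c + M - 1`. -/
def window (L : Fˣ →* Multiplicative (ZMod N)) (M : ℕ) (c : ZMod N) : Finset F :=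
  (Finset.univ.filter fun y : Fˣ => ∃ i < M, L y = Multiplicative.ofAdd (c + i)).map
    ⟨Units.val, Units.val_injective⟩

variable {L : Fˣ →* Multiplicative (ZMod N)} {M : ℕ} {c : ZMod N}

theorem mem_window {x : F} :
    x ∈ window L M c ↔ ∃ y : Fˣ, (∃ i < M, L y = Multiplicative.ofAdd (c + i)) ∧ (y : F) = x := by
  simp [window]

theorem sum_window {O : Type} [AddCommMonoid O] (hM : M ≤ N) (g : F → O) :
    ∑ x ∈ window L M c, g x = ∑ i ∈ Finset.range M, ∑ y : Fˣ,
      if L y = Multiplicative.ofAdd (c + i) then g y else 0 := by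
  rw [window, Finset.sum_map, Finset.sum_filter, Finset.sum_comm]
  refine Finset.sum_congr rfl fun y _ => ?_
  split_ifs with h
  · obtain ⟨i, hi, hy⟩ := h
    rw [Finset.sum_eq_single_of_mem i (Finset.mem_range.2 hi), if_pos hy]
    · rfl
    · intro j hj hji
      rw [if_neg]
      intro hy'
      have h1 := add_left_cancel (Multiplicative.ofAdd.injective (hy.symm.trans hy'))
      have h2 := (ZMod.natCast_eq_natCast_iff' i j N).1 h1
      rw [Nat.mod_eq_of_lt (hi.trans_le hM),
        Nat.mod_eq_of_lt ((Finset.mem_range.1 hj).trans_le hM)] at h2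
      exact hji h2.symm
  · refine (Finset.sum_eq_zero fun i hi => if_neg fun hy => h ⟨i, Finset.mem_range.1 hi, hy⟩).symm

theorem sum_window_addChar {O : Type} [CommRing O] (hM : M ≤ N) (ψ : AddChar F O) (u : Fˣ) :
    ∑ x ∈ window L M c, ψ (u * x) =
      ∑ i ∈ Finset.range M, classSum L ψ ((L u).toAdd + c + i) := by
  rw [sum_window hM]
  refine Finset.sum_congr rfl fun i _ => ?_
  symm
  rw [classSum, ← (Equiv.mulLeft u).bijective.sum_comp]
  refine Finset.sum_congr rfl fun y _ => ?_
  rw [Equiv.coe_mulLeft, Units.val_mul, map_mul, add_assoc, ofAdd_add, ofAdd_toAdd]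
  exact if_congr mul_left_cancel_iff rfl rfl

theorem card_window [NeZero N] (hM : M ≤ N) (hL : Function.Surjective L) {k : ℕ}
    (hk : Fintype.card F - 1 = N * k) : (window L M c).card = M * k := by
  have hfib : ∀ a, (Finset.univ.filter fun y : Fˣ => L y = a).card = k := by
    intro a
    have h1 : Fintype.card Fˣ = ∑ b : Multiplicative (ZMod N),
        (Finset.univ.filter fun y : Fˣ => L y = b).card :=
      Finset.card_eq_sum_card_fiberwise fun _ _ => Finset.mem_coe.2 (Finset.mem_univ _)
    rw [Finset.sum_congr rfl fun b _ => MonoidHom.card_fiber_eq_of_mem_range L (hL b) (hL a),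
      Finset.sum_const, Fintype.card_units, hk, Finset.card_univ, Fintype.card_multiplicative,
      ZMod.card, smul_eq_mul] at h1
    exact (Nat.eq_of_mul_eq_mul_left (NeZero.pos N) h1).symm
  rw [Finset.card_eq_sum_ones, sum_window hM]
  simp only [← Finset.sum_filter, ← Finset.card_eq_sum_ones, hfib]
  simp

theorem mem_window_iff_exists_pow [NeZero N] {γ : Fˣ} (hγ : ∀ x, x ∈ Subgroup.zpowers γ)
    (hL : L γ = Multiplicative.ofAdd 1) (hN : N ∣ orderOf γ) (j : ℕ) {x : F} :
    x ∈ window L M j ↔ ∃ i < M, ∃ t : ℕ, x = (γ : F) ^ (i + j + N * t) := by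
  have hLn : ∀ n : ℕ, L (γ ^ n) = Multiplicative.ofAdd (n : ZMod N) := fun n => by
    rw [map_pow, hL, ← ofAdd_nsmul, nsmul_one]
  rw [mem_window]
  constructor
  · rintro ⟨y, ⟨i, hi, hy⟩, rfl⟩
    obtain ⟨n, rfl⟩ := mem_powers_iff_mem_zpowers.2 (hγ y)
    obtain ⟨d, hd⟩ := hN
    have hd0 : 0 < orderOf γ := orderOf_pos γ
    simp only at hy ⊢
    rw [hLn, Multiplicative.ofAdd.injective.eq_iff] at hy
    have hle : i + j ≤ n + orderOf γ * (i + j) :=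
      (Nat.le_mul_of_pos_left _ hd0).trans (Nat.le_add_left _ _)
    have hmod : i + j ≡ n + orderOf γ * (i + j) [MOD N] := by
      rw [← ZMod.natCast_eq_natCast_iff, hd]
      push_cast
      rw [hy, ZMod.natCast_self]
      ring
    obtain ⟨t, ht⟩ := (Nat.modEq_iff_dvd' hle).1 hmod
    refine ⟨i, hi, t, ?_⟩
    rw [← ht, Nat.add_sub_cancel' hle, ← Units.val_pow_eq_pow_val, pow_add, pow_mul,
      pow_orderOf_eq_one, one_pow, mul_one]
  · rintro ⟨i, hi, t, rfl⟩
    refine ⟨γ ^ (i + j + N * t), ⟨i, hi, ?_⟩, Units.val_pow_eq_pow_val _ _⟩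
    rw [hLn]
    push_cast
    rw [ZMod.natCast_self]
    ring_nf

theorem zero_notMem_window : (0 : F) ∉ window L M c := fun h => by
  obtain ⟨y, -, hy⟩ := mem_window.1 h
  exact y.ne_zero hy

theorem neg_mem_window (hL : L (-1) = 1) {x : F} (hx : x ∈ window L M c) : -x ∈ window L M c := by
  obtain ⟨y, hy, rfl⟩ := mem_window.1 hx
  refine mem_window.2 ⟨-y, ?_, Units.val_neg y⟩
  rwa [← neg_one_mul, map_mul, hL, one_mul]

end Windows

theorem sum_window_addChar_cases {s : ℕ} {F : Type} [Field F] [Fintype F] [Algebra (ZMod 17) F]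
    {L : Fˣ →* Multiplicative (ZMod (67 ^ (s + 1)))} {γ : Fˣ} {ζ : PadicAlgInt 17}
    (hF : Fintype.card F = 17 ^ (33 * 67 ^ s)) (hγ : ∀ x, x ∈ Subgroup.zpowers γ)
    (hL : L γ = Multiplicative.ofAdd 1) (hζ : IsPrimitiveRoot ζ 17) :
    ∃ α β, ∀ c, ∀ a ≠ 0,
      ∑ x ∈ window L (67 ^ s) c, PadicAlgInt.traceChar F hζ (a * x) = α ∨
      ∑ x ∈ window L (67 ^ s) c, PadicAlgInt.traceChar F hζ (a * x) = β := by
  have : CharP F 17 := charP_of_injective_algebraMap' (ZMod 17) 17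
  have hg : ∀ c, classSum L (PadicAlgInt.traceChar F hζ) (17 * c) =
      classSum L (PadicAlgInt.traceChar F hζ) c :=
    classSum_natCast_mul L (PadicAlgInt.traceChar F hζ) (p := 17)
      (Nat.Coprime.pow_right _ (by norm_num)) (PadicAlgInt.traceChar_pow hζ)
  obtain ⟨K, hK⟩ := window_sum_cases hg
  refine ⟨K + classSum L (PadicAlgInt.traceChar F hζ) (inflate s 1),
    K + classSum L (PadicAlgInt.traceChar F hζ) (inflate s (-1)), fun c a ha => ?_⟩
  obtain ⟨b, hb⟩ := hK ((L (Units.mk0 a ha)).toAdd + c)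
  rw [← sum_window_addChar (Nat.pow_le_pow_right (by norm_num) (Nat.le_succ s)),
    Units.val_mk0] at hb
  rw [hb]
  rcases apply_inflate_cases hg b with h | h | h
  · rw [h]
    exact (classSum_zero_eq hF hγ hL hζ).imp (congrArg _) (congrArg _)
  · exact Or.inl (congrArg _ h)
  · exact Or.inr (congrArg _ h)

theorem fromRel_ne_top_of_card_lt {F : Type} [Field F] [Fintype F] {S : Finset F}
    (hneg : ∀ x ∈ S, -x ∈ S) (h : S.card < Fintype.card F - 1) :
    SimpleGraph.fromRel (fun x y : F => x - y ∈ S) ≠ ⊤ := by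
  intro htop
  have hsub : Finset.univ.erase (0 : F) ⊆ S := by
    intro x hx
    have h1 : (SimpleGraph.fromRel (fun x y : F => x - y ∈ S)).Adj x 0 := by
      rw [htop]
      exact Finset.ne_of_mem_erase hx
    rcases h1.2 with h2 | h2
    · simpa using h2
    · simpa using hneg _ h2
  have := Finset.card_le_card hsub
  rw [Finset.card_erase_of_mem (Finset.mem_univ _), Finset.card_univ] at this
  omega

theorem fromRel_ne_bot_of_nonempty {F : Type} [Field F] {S : Finset F} (h0 : (0 : F) ∉ S)
    (h : S.Nonempty) : SimpleGraph.fromRel (fun x y : F => x - y ∈ S) ≠ ⊥ := by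
  intro hbot
  obtain ⟨x, hx⟩ := h
  have h1 : (SimpleGraph.fromRel (fun x y : F => x - y ∈ S)).Adj x 0 :=
    ⟨by rintro rfl; exact h0 hx, Or.inl (by simpa using hx)⟩
  rw [hbot] at h1
  exact h1

/-- Each `Cay(F_q, D_k)` is a strongly regular graph of degree `(q-1)/67`,
where `q = 17^{33*67^(m-1)}`, `N = 67^m`. -/
theorem cayley_srg_example_18
    (m N q : ℕ) (hm : 1 ≤ m)
    (hN : N = 67 ^ m) (hq : q = 17 ^ (33 * 67 ^ (m - 1)))
    (F : Type) [Field F] [Fintype F] (hF : Fintype.card F = q)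
    (γ : Fˣ) (hγ : orderOf γ = q - 1)
    (D : ℕ → Set F)
    (hD : ∀ k, D k = {x : F | ∃ i < 67 ^ (m - 1), ∃ t : ℕ,
        x = ((γ : F)) ^ (i + k * 67 ^ (m - 1) + N * t)}) :
    ∀ k ≤ 66,
      SimpleGraph.fromRel (fun x y : F => x - y ∈ D k) ≠ ⊤ ∧
      SimpleGraph.fromRel (fun x y : F => x - y ∈ D k) ≠ ⊥ ∧
      ∃ l u : ℕ, (SimpleGraph.fromRel (fun x y : F => x - y ∈ D k)).IsSRGWith
        q ((q - 1) / 67) l u := by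
  obtain ⟨s, rfl⟩ := Nat.exists_eq_add_of_le' hm
  rw [Nat.add_sub_cancel] at *
  subst hN
  intro k _
  have hF' : Fintype.card F = 17 ^ (33 * 67 ^ s) := hF.trans hq
  have : CharP F 17 := charP_of_card_eq_prime_pow hF'
  let : Algebra (ZMod 17) F := ZMod.algebra F 17
  have hγ' : ∀ x, x ∈ Subgroup.zpowers γ := by
    have : Subgroup.zpowers γ = ⊤ := Subgroup.eq_top_of_card_eq _ (by
      rw [Nat.card_zpowers, hγ, Nat.card_eq_fintype_card, Fintype.card_units, hF])
    simp [this]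
  have hdvd := (pow_dvd_pow_sub_one_iff s _).2 (dvd_refl (33 * 67 ^ s))
  rw [← hq] at hdvd
  have ho : orderOf (Multiplicative.ofAdd (1 : ZMod (67 ^ (s + 1)))) ∣ orderOf γ := by
    rwa [orderOf_ofAdd_eq_addOrderOf, ZMod.addOrderOf_one, hγ]
  set L := monoidHomOfForallMemZpowers hγ' ho
  have hL : L γ = Multiplicative.ofAdd 1 := monoidHomOfForallMemZpowers_apply_gen hγ' ho
  have hLneg : L (-1) = 1 :=
    map_neg_one_eq_one (p := 17) L (Nat.Coprime.pow_right _ (by norm_num))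
  have hLsurj : Function.Surjective L := fun a =>
    ⟨γ ^ a.toAdd.val, by rw [map_pow, hL, ← ofAdd_nsmul, nsmul_one, ZMod.natCast_zmod_val]; rfl⟩
  obtain ⟨ζ, hζ⟩ := PadicAlgInt.exists_isPrimitiveRoot 17 17
  obtain ⟨α, β, hαβ⟩ := sum_window_addChar_cases hF' hγ' hL hζ
  set S := window L (67 ^ s) ((k * 67 ^ s : ℕ) : ZMod (67 ^ (s + 1))) with hS
  have hDS : ∀ x, x ∈ D k ↔ x ∈ S := fun x => by
    rw [hD, hS, mem_window_iff_exists_pow hγ' hL (hγ ▸ hdvd)]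
    rfl
  have h0 : (0 : F) ∉ S := zero_notMem_window
  have hneg : ∀ x ∈ S, -x ∈ S := fun x hx => neg_mem_window hLneg hx
  obtain ⟨d, hd⟩ := hdvd
  have hcard : S.card = 67 ^ s * d :=
    card_window (Nat.pow_le_pow_right (by norm_num) (Nat.le_succ s)) hLsurj (hF ▸ hd)
  have hdeg : q - 1 = 67 * S.card := by rw [hd, hcard, pow_succ']; ring
  have hq1 : 17 ^ 1 ≤ q := by
    rw [hq]
    exact Nat.pow_le_pow_right (by norm_num) (Nat.mul_pos (by norm_num) (by positivity))
  rw [show (q - 1) / 67 = S.card by omega, ← hF]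
  simp only [hDS]
  exact ⟨fromRel_ne_top_of_card_lt hneg (by omega),
    fromRel_ne_bot_of_nonempty h0 (Finset.card_pos.1 (by omega)),
    fromRel_sub_mem_isSRGWith h0 hneg (PadicAlgInt.traceChar_isPrimitive hζ) (hαβ _)⟩
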